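/- Let q be a prime power and S a surface of degree d in P^3 over F_q without F_q-plane components, with 2 ≤ d ≤ q+1 and N_q(S) = (d-1)q^2 + dq + 1. Then for every F_q-point P of S there exists an F_q-plane H containing P such that S ∩ H is a planar F_q-pencil of degree d with vertex v_{S∩H} = P. -/

import Mathlib

open MvPolynomial

variable {K : Type} [Field K]

/-- The linear form `∑ aᵢ Xᵢ` as a multivariate polynomial. -/
noncomputable def linForm {n : ℕ} (a : Fin n → K) : MvPolynomial (Fin n) K :=
  ∑ i, C (a i) * X i

/-- The linear form `v ↦ ∑ aᵢ vᵢ` as a linear map. -/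
noncomputable def linMap {n : ℕ} (a : Fin n → K) : (Fin n → K) →ₗ[K] K :=
  ∑ i, a i • LinearMap.proj i

/-- Substitution `F(M·X)` of a linear change of variables into `F`. -/
noncomputable def substLin {n : ℕ} (M : Matrix (Fin n) (Fin n) K)
    (F : MvPolynomial (Fin n) K) : MvPolynomial (Fin n) K :=
  MvPolynomial.aeval (fun i => ∑ j, C (M i j) * X j) F

/-- Projective equivalence over `K` of two forms. -/
def ProjEquiv {n : ℕ} (F G : MvPolynomial (Fin n) K) : Prop :=
  ∃ M : Matrix (Fin n) (Fin n) K, IsUnit M.det ∧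
    ∃ c : K, c ≠ 0 ∧ substLin M F = C c * G

/-- An `F_q`-line in `P^3` (resp. `P^2`), as a 2-dimensional linear subspace. -/
def IsLine {n : ℕ} (W : Submodule K (Fin n → K)) : Prop := Module.finrank K W = 2

/-- An `F_q`-plane in `P^3`, as a 3-dimensional linear subspace. -/
def IsPlane (W : Submodule K (Fin 4 → K)) : Prop := Module.finrank K W = 3

/-- The section `S ∩ H` of the surface `S = {F = 0}` with the plane `H` given by the
subspace `W` is a planar `F_q`-pencil of degree `d` with vertex `P`: modulo the linear
form defining `H`, `F` is a nonzero scalar times a product of `d` linear forms over `F_q`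
cutting out `d` pairwise distinct lines of `H`, all passing through the point `P`. -/
def IsPencil (F : MvPolynomial (Fin 4) K) (d : ℕ)
    (W : Submodule K (Fin 4 → K)) (P : Projectivization K (Fin 4 → K)) : Prop :=
  ∃ (a : Fin 4 → K) (m : Fin d → Fin 4 → K) (c : K) (g : MvPolynomial (Fin 4) K),
    a ≠ 0 ∧ W = LinearMap.ker (linMap a) ∧ c ≠ 0 ∧
    F = C c * (∏ i, linForm (m i)) + linForm a * g ∧
    (∀ i, IsLine (LinearMap.ker (linMap a) ⊓ LinearMap.ker (linMap (m i)))) ∧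
    (∀ i j, i ≠ j →
      LinearMap.ker (linMap a) ⊓ LinearMap.ker (linMap (m i)) ≠
      LinearMap.ker (linMap a) ⊓ LinearMap.ker (linMap (m j))) ∧
    P.rep ∈ W ∧ (∀ i, linMap (m i) P.rep = 0)

/-- The restriction of `F` to the plane `H` given by the subspace `W` has a linear
factor over `F_q` (i.e. the section `S ∩ H` has an `F_q`-line component). -/
def SectionHasLineComp (F : MvPolynomial (Fin 4) K)
    (W : Submodule K (Fin 4 → K)) : Prop :=
  ∃ (a b : Fin 4 → K) (h g : MvPolynomial (Fin 4) K),
    a ≠ 0 ∧ W = LinearMap.ker (linMap a) ∧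
    IsLine (LinearMap.ker (linMap a) ⊓ LinearMap.ker (linMap b)) ∧
    F = linForm b * h + linForm a * g

/-- The expansion of `F (x + t • p)` as a polynomial in `t` with coefficients polynomials in `x`. -/
noncomputable def lineExpansion {n : ℕ} (p : Fin n → K) (F : MvPolynomial (Fin n) K) :
    Polynomial (MvPolynomial (Fin n) K) :=
  aeval (fun i => Polynomial.C (X i) + Polynomial.X * Polynomial.C (C (p i))) F

lemma lineExpansion_eq_finSuccEquiv {n : ℕ} (p : Fin n → K) (F : MvPolynomial (Fin n) K) :
    lineExpansion p F = finSuccEquiv K n (aeval (fun i => X i.succ + X 0 * C (p i)) F) := by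
  have h : (finSuccEquiv K n).toAlgHom.comp (aeval (fun i : Fin n => X i.succ + X 0 * C (p i))) =
      aeval (fun i => Polynomial.C (X i) + Polynomial.X * Polynomial.C (C (p i))) := by
    ext i : 1
    simp [finSuccEquiv_apply]
  rw [lineExpansion, ← h]
  rfl

lemma isHomogeneous_aeval_add_mul {n d : ℕ} (p : Fin n → K) {F : MvPolynomial (Fin n) K}
    (hF : F.IsHomogeneous d) :
    (aeval (fun i : Fin n => (X i.succ + X 0 * C (p i) : MvPolynomial (Fin (n + 1)) K))
      F).IsHomogeneous d := by
  have h := hF.aeval (n := 1) (fun i : Fin n =>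
    (X i.succ + X 0 * C (p i) : MvPolynomial (Fin (n + 1)) K)) fun i =>
      (isHomogeneous_X _ _).add (by simpa [mul_comm] using isHomogeneous_C_mul_X (p i) 0)
  simpa using h

lemma lineExpansion_coeff_isHomogeneous {n d : ℕ} (p : Fin n → K) {F : MvPolynomial (Fin n) K}
    (hF : F.IsHomogeneous d) {k e : ℕ} (h : k + e = d) :
    ((lineExpansion p F).coeff k).IsHomogeneous e := by
  rw [lineExpansion_eq_finSuccEquiv]
  exact (isHomogeneous_aeval_add_mul p hF).finSuccEquiv_coeff_isHomogeneous k e h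

lemma lineExpansion_coeff_eq_zero {n d : ℕ} (p : Fin n → K) {F : MvPolynomial (Fin n) K}
    (hF : F.IsHomogeneous d) {k : ℕ} (h : d < k) : (lineExpansion p F).coeff k = 0 := by
  rw [lineExpansion_eq_finSuccEquiv]
  apply Polynomial.coeff_eq_zero_of_natDegree_lt
  rw [natDegree_finSuccEquiv]
  exact ((degreeOf_le_totalDegree _ _).trans
    (isHomogeneous_aeval_add_mul p hF).totalDegree_le).trans_lt h

lemma lineExpansion_map_aeval {n : ℕ} (p : Fin n → K) (F : MvPolynomial (Fin n) K)
    {B : Type*} [CommRing B] [Algebra K B] (x : Fin n → B) :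
    (lineExpansion p F).map (aeval x : MvPolynomial (Fin n) K →ₐ[K] B).toRingHom =
      aeval (fun i => Polynomial.C (x i) + Polynomial.X * Polynomial.C (algebraMap K B (p i))) F := by
  have h : (Polynomial.mapAlgHom (aeval x : MvPolynomial (Fin n) K →ₐ[K] B)).comp
      (aeval (fun i => Polynomial.C (X i) + Polynomial.X * Polynomial.C (C (p i)))) =
      aeval (fun i => Polynomial.C (x i) + Polynomial.X * Polynomial.C (algebraMap K B (p i))) := by
    ext i : 1
    simp
  rw [← h]
  rfl

lemma MvPolynomial.IsHomogeneous.aeval_mul {σ B : Type*} [CommRing B] [Algebra K B] {d : ℕ}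
    {F : MvPolynomial σ K} (hF : F.IsHomogeneous d) (c : B) (x : σ → B) :
    MvPolynomial.aeval (fun i => c * x i) F = c ^ d * MvPolynomial.aeval x F := by
  simp only [aeval_def, eval₂_eq, Finset.mul_sum]
  refine Finset.sum_congr rfl fun m hm => ?_
  have hd : m.degree = d := by
    by_contra h
    exact (mem_support_iff.mp hm) (hF.coeff_eq_zero h)
  simp only [mul_pow, Finset.prod_mul_distrib, Finset.prod_pow_eq_pow_sum]
  rw [← hd, Finsupp.degree_apply]
  ring

lemma MvPolynomial.IsHomogeneous.eval_smul {σ : Type*} {d : ℕ}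
    {F : MvPolynomial σ K} (hF : F.IsHomogeneous d) (c : K) (x : σ → K) :
    eval (c • x) F = c ^ d * eval x F := by
  rw [← coe_aeval_eq_eval, ← coe_aeval_eq_eval]
  exact hF.aeval_mul c x

/-- The restriction of `F` to the line `t ↦ v + t • p`. -/
noncomputable def lineRestriction {n : ℕ} (p : Fin n → K) (F : MvPolynomial (Fin n) K)
    (v : Fin n → K) : Polynomial K :=
  (lineExpansion p F).map (eval v)

lemma coeff_lineRestriction {n : ℕ} (p : Fin n → K) (F : MvPolynomial (Fin n) K)
    (v : Fin n → K) (k : ℕ) :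
    (lineRestriction p F v).coeff k = eval v ((lineExpansion p F).coeff k) := by
  simp [lineRestriction]

lemma lineRestriction_eq_aeval {n : ℕ} (p : Fin n → K) (F : MvPolynomial (Fin n) K)
    (v : Fin n → K) :
    lineRestriction p F v =
      aeval (fun i => Polynomial.C (v i) + Polynomial.X * Polynomial.C (p i)) F :=
  lineExpansion_map_aeval p F v

lemma eval_lineRestriction {n : ℕ} (p : Fin n → K) (F : MvPolynomial (Fin n) K)
    (v : Fin n → K) (t : K) : (lineRestriction p F v).eval t = eval (v + t • p) F := by
  have h : (Polynomial.aeval t).comp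
      (aeval (fun i => Polynomial.C (v i) + Polynomial.X * Polynomial.C (p i))) =
      (aeval (v + t • p) : MvPolynomial (Fin n) K →ₐ[K] K) := by
    ext i : 1
    simp
    ring
  rw [lineRestriction_eq_aeval, ← Polynomial.coe_aeval_eq_eval, ← coe_aeval_eq_eval, ← h]
  rfl

lemma lineExpansion_coeff_self {n d : ℕ} (p : Fin n → K) {F : MvPolynomial (Fin n) K}
    (hF : F.IsHomogeneous d) : (lineExpansion p F).coeff d = C (eval p F) := by
  have h0 := lineExpansion_coeff_isHomogeneous p hF (add_zero d)
  have hC := totalDegree_eq_zero_iff_eq_C.mp ((totalDegree_zero_iff_isHomogeneous _).mpr h0)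
  have hp : lineRestriction p F 0 = Polynomial.X ^ d * Polynomial.C (eval p F) := by
    rw [lineRestriction_eq_aeval]
    have := hF.aeval_mul (Polynomial.X : Polynomial K) (fun i => Polynomial.C (p i))
    simp only [Pi.zero_apply, map_zero, zero_add, this]
    congr 1
    rw [← coe_aeval_eq_eval]
    exact aeval_algebraMap_apply (Polynomial K) p F
  have := congrArg (fun f => Polynomial.coeff f d) hp
  simp only [lineRestriction, Polynomial.coeff_map] at this
  rw [hC] at this ⊢
  simpa using this

lemma MvPolynomial.IsHomogeneous.exists_linearMap {n : ℕ} {G : MvPolynomial (Fin n) K}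
    (hG : G.IsHomogeneous 1) : ∃ l : (Fin n → K) →ₗ[K] K, ∀ v, eval v G = l v := by
  have h : G ∈ homogeneousSubmodule (Fin n) K 1 := hG
  rw [homogeneousSubmodule_one_eq_span_X] at h
  clear hG
  induction h using Submodule.span_induction with
  | mem G hG =>
    obtain ⟨i, rfl⟩ := hG
    exact ⟨LinearMap.proj i, fun v => by simp⟩
  | zero => exact ⟨0, fun v => by simp⟩
  | add G G' _ _ h h' =>
    obtain ⟨l, hl⟩ := h
    obtain ⟨l', hl'⟩ := h'
    exact ⟨l + l', fun v => by simp [hl, hl']⟩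
  | smul c G _ h =>
    obtain ⟨l, hl⟩ := h
    exact ⟨c • l, fun v => by simp [hl, smul_eval]⟩

/-- The restriction of `F` to the affine plane `(s, t) ↦ u + s • w + t • p`, as a polynomial in `t`
with coefficients polynomials in `s`. -/
noncomputable def planeRestriction {n : ℕ} (p w : Fin n → K) (F : MvPolynomial (Fin n) K)
    (u : Fin n → K) : Polynomial (Polynomial K) :=
  (lineExpansion p F).map
    (aeval fun i => Polynomial.C (u i) + Polynomial.X * Polynomial.C (w i) :
      MvPolynomial (Fin n) K →ₐ[K] Polynomial K).toRingHom

lemma coeff_planeRestriction {n : ℕ} (p w : Fin n → K) (F : MvPolynomial (Fin n) K)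
    (u : Fin n → K) (k : ℕ) : (planeRestriction p w F u).coeff k =
      lineRestriction w ((lineExpansion p F).coeff k) u := by
  rw [planeRestriction, Polynomial.coeff_map, lineRestriction_eq_aeval]
  rfl

lemma planeRestriction_map_eval {n : ℕ} (p w : Fin n → K) (F : MvPolynomial (Fin n) K)
    (u : Fin n → K) (s : K) :
    (planeRestriction p w F u).map (Polynomial.evalRingHom s) = lineRestriction p F (u + s • w) := by
  ext k
  rw [Polynomial.coeff_map, coeff_planeRestriction, coeff_lineRestriction,
    Polynomial.coe_evalRingHom, eval_lineRestriction]

lemma coeff_coeff_planeRestriction_eq_zero {n d : ℕ} {p w : Fin n → K}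
    {F : MvPolynomial (Fin n) K} (hF : F.IsHomogeneous d) (hw : lineRestriction p F w = 0)
    (u : Fin n → K) {k j : ℕ} (h : d ≤ k + j) : ((planeRestriction p w F u).coeff k).coeff j = 0 := by
  rw [coeff_planeRestriction]
  rcases lt_or_ge d k with hk | hk
  · rw [lineExpansion_coeff_eq_zero p hF hk]
    simp [lineRestriction, lineExpansion]
  have hc := lineExpansion_coeff_isHomogeneous p hF (Nat.add_sub_cancel' hk)
  rw [coeff_lineRestriction]
  rcases h.lt_or_eq with h | h
  · rw [lineExpansion_coeff_eq_zero w hc (by omega), map_zero]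
  · obtain rfl : j = d - k := by omega
    rw [lineExpansion_coeff_self w hc, eval_C, ← coeff_lineRestriction, hw, Polynomial.coeff_zero]

section Bivariate

open Polynomial

variable {n : ℕ} {Q : K[X][X]}

lemma coeff_eq_zero_of_map_eval_eq_zero (hQ : ∀ k j, n < k + j → (Q.coeff k).coeff j = 0)
    {T : Finset K} (hT : ∀ s ∈ T, Q.map (evalRingHom s) = 0) {k : ℕ} (hk : n < k + T.card) :
    Q.coeff k = 0 := by
  by_contra h
  have hdeg : k + (Q.coeff k).natDegree ≤ n := by
    by_contra h'
    exact h (leadingCoeff_eq_zero.mp (hQ k _ (not_le.mp h')))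
  refine h (eq_zero_of_natDegree_lt_card_of_eval_eq_zero' _ T (fun s hs => ?_) (by omega))
  simpa using congrArg (fun f => f.coeff k) (hT s hs)

lemma eq_C_prod_of_map_eval_eq_zero (hQ : ∀ k j, n < k + j → (Q.coeff k).coeff j = 0)
    {T : Finset K} (hT : ∀ s ∈ T, Q.map (evalRingHom s) = 0) (hn : T.card = n) :
    ∃ c : K, Q = Polynomial.C (Polynomial.C c * ∏ s ∈ T, (Polynomial.X - Polynomial.C s)) := by
  have h0 : Q = Polynomial.C (Q.coeff 0) := by
    ext1 k
    rcases Nat.eq_zero_or_pos k with rfl | hk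
    · simp
    · rw [coeff_eq_zero_of_map_eval_eq_zero hQ hT (by omega), Polynomial.coeff_C_of_ne_zero hk.ne']
  refine ⟨(Q.coeff 0).coeff n, ?_⟩
  conv_lhs => rw [h0]
  congr 1
  rw [← sub_eq_zero]
  have hmonic : (∏ s ∈ T, (Polynomial.X - Polynomial.C s)).Monic :=
    monic_prod_of_monic _ _ fun s _ => monic_X_sub_C s
  have hprod : (∏ s ∈ T, (Polynomial.X - Polynomial.C s)).natDegree = n := by
    rw [natDegree_prod_of_monic _ _ fun s _ => monic_X_sub_C s]
    simp [hn]
  refine eq_zero_of_degree_lt_of_eval_finset_eq_zero T ?_ fun s hs => ?_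
  · rw [hn, degree_lt_iff_coeff_zero]
    intro m hm
    rw [Polynomial.coeff_sub, Polynomial.coeff_C_mul]
    rcases hm.eq_or_lt with rfl | hm
    · nth_rewrite 3 [← hprod]
      rw [hmonic.coeff_natDegree, mul_one, sub_self]
    · rw [hQ 0 m (by omega), coeff_eq_zero_of_natDegree_lt
        (p := ∏ s ∈ T, (Polynomial.X - Polynomial.C s)) (by omega)]
      simp
  · have h1 : eval s (Q.coeff 0) = 0 := by
      simpa using congrArg (fun f => f.coeff 0) (hT s hs)
    have h2 : eval s (∏ s ∈ T, (Polynomial.X - Polynomial.C s)) = 0 := by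
      rw [Polynomial.eval_prod]
      exact Finset.prod_eq_zero hs (by simp)
    simp [h1, h2]

variable [Fintype K] [DecidableEq K]

/-- The number of zeros of a univariate polynomial over a finite field. -/
def zeroCount (f : K[X]) : ℕ := (Finset.univ.filter fun t => f.eval t = 0).card

lemma zeroCount_le_card (f : K[X]) : zeroCount f ≤ Fintype.card K := Finset.card_le_univ _

lemma zeroCount_le {f : K[X]} (hf : f ≠ 0) {m : ℕ} (hm : ∀ k, m < k → f.coeff k = 0) :
    zeroCount f ≤ m := by
  by_contra! h
  exact hf (eq_zero_of_natDegree_lt_card_of_eval_eq_zero' f _ (fun t ht => by simpa using ht)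
    ((natDegree_le_iff_coeff_eq_zero.mpr hm).trans_lt h))

lemma sum_zeroCount_map_eval_le (T : Finset K) {m : ℕ}
    (hT : ∀ s ∉ T, Q.map (evalRingHom s) ≠ 0) (hQ : ∀ k, m < k → Q.coeff k = 0) :
    ∑ s, zeroCount (Q.map (evalRingHom s)) ≤
      T.card * Fintype.card K + (Fintype.card K - T.card) * m := by
  rw [← Finset.sum_add_sum_compl T, ← Finset.card_compl]
  refine Nat.add_le_add (Finset.sum_le_card_nsmul _ _ _ fun s _ => zeroCount_le_card _)
    (Finset.sum_le_card_nsmul _ _ _ fun s hs => zeroCount_le (hT s (Finset.mem_compl.mp hs)) ?_)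
  intro k hk
  rw [Polynomial.coeff_map, hQ k hk, map_zero]

theorem sum_zeroCount_le (hQ : ∀ k j, n < k + j → (Q.coeff k).coeff j = 0) (hQ0 : Q ≠ 0) :
    ∑ s, zeroCount (Q.map (evalRingHom s)) ≤ n * Fintype.card K := by
  set T : Finset K := Finset.univ.filter fun s => Q.map (evalRingHom s) = 0 with hT
  have hTn : T.card ≤ n := by
    by_contra! h
    refine hQ0 (Polynomial.ext fun k => ?_)
    exact coeff_eq_zero_of_map_eval_eq_zero hQ (T := T) (by simp [hT]) (by omega)
  have hTq : T.card ≤ Fintype.card K := Finset.card_le_univ T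
  refine (sum_zeroCount_map_eval_le (m := n - T.card) T (by simp [hT]) fun k hk =>
    coeff_eq_zero_of_map_eval_eq_zero hQ (T := T) (by simp [hT]) (by omega)).trans ?_
  obtain ⟨e, he⟩ := Nat.exists_eq_add_of_le hTn
  obtain ⟨f, hf⟩ := Nat.exists_eq_add_of_le hTq
  rw [he, hf, Nat.add_sub_cancel_left, Nat.add_sub_cancel_left]
  nlinarith [Nat.zero_le (T.card * e)]

theorem exists_eq_C_prod_of_sum_zeroCount_eq
    (hQ : ∀ k j, n < k + j → (Q.coeff k).coeff j = 0)
    (hQ0 : Q ≠ 0) (hQn : Q.coeff n = 0)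
    (hsum : ∑ s, zeroCount (Q.map (evalRingHom s)) = n * Fintype.card K) :
    ∃ (T : Finset K) (c : K), T.card = n ∧
      Q = Polynomial.C (Polynomial.C c * ∏ s ∈ T, (Polynomial.X - Polynomial.C s)) := by
  set T : Finset K := Finset.univ.filter fun s => Q.map (evalRingHom s) = 0 with hT
  have hTn : T.card ≤ n := by
    by_contra! h
    refine hQ0 (Polynomial.ext fun k => ?_)
    exact coeff_eq_zero_of_map_eval_eq_zero hQ (T := T) (by simp [hT]) (by omega)
  have hTq : T.card ≤ Fintype.card K := Finset.card_le_univ T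
  have hcard : T.card = n := by
    by_contra hne
    have hq : 0 < Fintype.card K := Fintype.card_pos
    rcases Nat.eq_zero_or_pos T.card with h0 | hpos
    · have := sum_zeroCount_map_eval_le (Q := Q) (m := n - 1) T (by simp [hT]) fun k hk => by
        rcases (show n ≤ k by omega).eq_or_lt with rfl | hk
        · exact hQn
        · exact coeff_eq_zero_of_map_eval_eq_zero hQ (T := ∅) (by simp) (by simpa using hk)
      rw [hsum, h0, zero_mul, zero_add, Nat.sub_zero, mul_comm] at this
      have := Nat.le_of_mul_le_mul_left this hq
      omega
    · have := sum_zeroCount_map_eval_le (Q := Q) (m := n - T.card) T (by simp [hT]) fun k hk =>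
        coeff_eq_zero_of_map_eval_eq_zero hQ (T := T) (by simp [hT]) (by omega)
      rw [hsum] at this
      obtain ⟨e, he⟩ := Nat.exists_eq_add_of_le hTn
      obtain ⟨f, hf⟩ := Nat.exists_eq_add_of_le hTq
      have he0 : 0 < e := by omega
      rw [he, hf, Nat.add_sub_cancel_left, Nat.add_sub_cancel_left] at this
      nlinarith [Nat.mul_pos hpos he0]
  obtain ⟨c, hc⟩ := eq_C_prod_of_map_eval_eq_zero hQ (T := T) (by simp [hT]) hcard
  exact ⟨T, c, hcard, hc⟩

end Bivariate

section Counting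

variable [Fintype K]

lemma card_zeros_eq {n d : ℕ} {F : MvPolynomial (Fin n) K} (hF : F.IsHomogeneous d) (hd : d ≠ 0)
    [DecidableEq K] :
    (Finset.univ.filter fun v => eval v F = 0).card = 1 + (Fintype.card K - 1) *
      Nat.card {p : Projectivization K (Fin n → K) // eval p.rep F = 0} := by
  have h0 : eval 0 F = 0 := by
    have := hF.eval_smul 0 (0 : Fin n → K)
    rwa [zero_smul, zero_pow hd, zero_mul] at this
  let f : {p : Projectivization K (Fin n → K) // eval p.rep F = 0} × Kˣ →
      {v : Fin n → K // v ≠ 0 ∧ eval v F = 0} := fun x => ⟨x.2 • x.1.1.rep,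
    by simpa [Units.smul_def] using x.1.1.rep_nonzero,
    by rw [Units.smul_def, hF.eval_smul, x.1.2, mul_zero]⟩
  have hf : Function.Bijective f := by
    constructor
    · rintro ⟨⟨p, hp⟩, c⟩ ⟨⟨p', hp'⟩, c'⟩ h
      have h : c • p.rep = c' • p'.rep := congrArg Subtype.val h
      obtain rfl : p = p' := by
        rw [← p.mk_rep, ← p'.mk_rep, Projectivization.mk_eq_mk_iff]
        exact ⟨c⁻¹ * c', by rw [mul_smul, ← h, inv_smul_smul]⟩
      have : c = c' := by
        ext
        exact smul_left_injective K p.rep_nonzero h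
      rw [this]
    · rintro ⟨v, hv, hFv⟩
      obtain ⟨c, hc⟩ := Projectivization.exists_smul_eq_mk_rep K v hv
      refine ⟨⟨⟨Projectivization.mk K v hv, ?_⟩, c⁻¹⟩, Subtype.ext ?_⟩
      · rw [← hc, Units.smul_def, hF.eval_smul, hFv, mul_zero]
      · change c⁻¹ • (Projectivization.mk K v hv).rep = v
        rw [← hc, inv_smul_smul]
  have hcard := Nat.card_congr (Equiv.ofBijective f hf)
  rw [Nat.card_prod, Nat.card_units, Nat.card_eq_fintype_card (α := K), mul_comm] at hcard
  rw [hcard, Nat.card_eq_fintype_card, Fintype.card_subtype]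
  have : (Finset.univ.filter fun v => eval v F = 0) =
      insert 0 (Finset.univ.filter fun v => v ≠ 0 ∧ eval v F = 0) := by
    ext v
    by_cases hv : v = 0
    · simpa [hv] using h0
    · simp [hv]
  rw [this, Finset.card_insert_of_notMem (by simp), add_comm]

lemma sum_sum_add_smul {V : Type*} [AddCommGroup V] [Module K V] [Fintype V] (w : V) (g : V → ℕ) :
    ∑ v, ∑ s : K, g (v + s • w) = Fintype.card K * ∑ v, g v := by
  have h : ∀ s : K, ∑ v, g (v + s • w) = ∑ v, g v := fun s =>
    Equiv.sum_comp (Equiv.addRight (s • w)) g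
  rw [Finset.sum_comm]
  simp [h]

lemma card_filter_mem {n : ℕ} (W : Submodule K (Fin n → K)) [DecidablePred (· ∈ W)] :
    (Finset.univ.filter (· ∈ W)).card = Fintype.card K ^ Module.finrank K W := by
  rw [← Fintype.card_subtype]
  exact Module.card_eq_pow_finrank (K := K) (V := W)

lemma card_filter_notMem {n : ℕ} (W : Submodule K (Fin n → K)) [DecidablePred (· ∈ W)] :
    (Finset.univ.filter (· ∉ W)).card + Fintype.card K ^ Module.finrank K W =
      Fintype.card K ^ n := by
  rw [← card_filter_mem W, add_comm, Finset.card_filter_add_card_filter_not]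
  simp

variable [DecidableEq K]

lemma zeroCount_lineRestriction {n : ℕ} (p : Fin n → K) (F : MvPolynomial (Fin n) K)
    (v : Fin n → K) : zeroCount (lineRestriction p F v) =
      ∑ t : K, if eval (v + t • p) F = 0 then 1 else 0 := by
  rw [zeroCount, Finset.card_filter]
  simp only [eval_lineRestriction]

lemma sum_zeroCount_lineRestriction {n : ℕ} (p : Fin n → K) (F : MvPolynomial (Fin n) K) :
    ∑ v, zeroCount (lineRestriction p F v) =
      Fintype.card K * (Finset.univ.filter fun v => eval v F = 0).card := by
  simp only [zeroCount_lineRestriction]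
  rw [sum_sum_add_smul p fun v => if eval v F = 0 then 1 else 0, Finset.card_filter]

lemma zeroCount_lineRestriction_of_forall {n : ℕ} {p v : Fin n → K} {F : MvPolynomial (Fin n) K}
    (h : ∀ t : K, eval (v + t • p) F = 0) :
    zeroCount (lineRestriction p F v) = Fintype.card K := by
  rw [zeroCount_lineRestriction]
  simp [h]

end Counting

lemma exists_notMem_of_finrank_lt_three (W : Submodule K (Fin 4 → K)) (hW : Module.finrank K W < 3)
    (l : (Fin 4 → K) →ₗ[K] K) : ∃ u, u ∉ W ∧ l u = 0 := by
  by_contra! h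
  have hle : LinearMap.ker l ≤ W := fun u hu => by
    by_contra hW
    exact h u hW hu
  have h1 := Submodule.finrank_mono hle
  have h2 := l.finrank_range_add_finrank_ker
  have h3 := (LinearMap.range l).finrank_le
  simp at h2 h3
  omega

lemma exists_linearMap_coeff_lineRestriction {n d : ℕ} {F : MvPolynomial (Fin n) K}
    (hF : F.IsHomogeneous (d + 1)) (p : Fin n → K) :
    ∃ l : (Fin n → K) →ₗ[K] K, ∀ v, (lineRestriction p F v).coeff d = l v := by
  obtain ⟨l, hl⟩ := (lineExpansion_coeff_isHomogeneous p hF rfl).exists_linearMap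
  exact ⟨l, fun v => by rw [coeff_lineRestriction, hl]⟩

lemma coeff_lineRestriction_eq_zero {n d : ℕ} {F : MvPolynomial (Fin n) K}
    (hF : F.IsHomogeneous d) {p : Fin n → K} (hp : eval p F = 0) (v : Fin n → K) {k : ℕ}
    (hk : d ≤ k) : (lineRestriction p F v).coeff k = 0 := by
  rw [coeff_lineRestriction]
  rcases hk.eq_or_lt with rfl | hk
  · rw [lineExpansion_coeff_self p hF, hp, map_zero, map_zero]
  · rw [lineExpansion_coeff_eq_zero p hF hk, map_zero]

lemma finrank_span_pair_eq_two {V : Type*} [AddCommGroup V] [Module K V] {w p : V} (hp : p ≠ 0)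
    (hw : w ∉ Submodule.span K {p}) : Module.finrank K (Submodule.span K {w, p}) = 2 := by
  have h : LinearIndependent K ![w, p] :=
    linearIndependent_finCons.mpr ⟨by simpa using hp, by simpa using hw⟩
  rw [← Matrix.range_cons_cons_empty w p ![]]
  simpa using finrank_span_eq_card h

section Extremal

variable [Fintype K] {e : ℕ} {F : MvPolynomial (Fin 4) K} {p : Fin 4 → K}

/-- Through every point of an extremal surface there is a line contained in the surface. -/
lemma exists_lineRestriction_eq_zero [DecidableEq K]
    (hF : F.IsHomogeneous (e + 1)) (he : e ≠ 0) (heq : e ≤ Fintype.card K)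
    (hN : (Finset.univ.filter fun v => eval v F = 0).card = 1 + (Fintype.card K - 1) *
      (e * Fintype.card K ^ 2 + (e + 1) * Fintype.card K + 1))
    (hp0 : p ≠ 0) (hp : eval p F = 0) :
    ∃ w, w ∉ Submodule.span K {p} ∧ lineRestriction p F w = 0 := by
  classical
  by_contra! h
  obtain ⟨l, hl⟩ := exists_linearMap_coeff_lineRestriction hF p
  have hrank : Module.finrank K (Submodule.span K {p}) = 1 := finrank_span_singleton hp0
  obtain ⟨u, hu, hlu⟩ := exists_notMem_of_finrank_lt_three (Submodule.span K {p}) (by omega) l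
  have hcard := card_filter_notMem (Submodule.span K {p})
  have hcard' := card_filter_mem (Submodule.span K {p})
  have hsum := sum_zeroCount_lineRestriction p F
  rw [← Finset.sum_filter_add_sum_filter_not _ (· ∈ Submodule.span K {p})] at hsum
  have hmem := Finset.sum_le_card_nsmul (Finset.univ.filter (· ∈ Submodule.span K {p}))
    (fun v => zeroCount (lineRestriction p F v)) (Fintype.card K) fun v _ => zeroCount_le_card _
  have hnot : ∑ v with v ∉ Submodule.span K {p}, zeroCount (lineRestriction p F v) <
      ∑ v with v ∉ Submodule.span K {p}, e := by
    refine Finset.sum_lt_sum (fun v hv => ?_) ⟨u, by simpa using hu, ?_⟩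
    · exact zeroCount_le (h v (by simpa using hv)) fun k hk => coeff_lineRestriction_eq_zero hF hp v hk
    · refine lt_of_le_of_lt (zeroCount_le (m := e - 1) (h u hu) fun k hk => ?_) (by omega)
      rcases (show e ≤ k by omega).eq_or_lt with rfl | hk
      · rw [hl, hlu]
      · exact coeff_lineRestriction_eq_zero hF hp u hk
  rw [Finset.sum_const, smul_eq_mul] at hnot
  rw [hrank, pow_one] at hcard hcard'
  rw [hcard', smul_eq_mul] at hmem
  rw [hN] at hsum
  obtain ⟨r, hr⟩ := Nat.exists_eq_add_of_lt (Fintype.one_lt_card (α := K))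
  generalize Fintype.card K = q at *
  obtain rfl : q = r + 2 := by omega
  have hM : (Finset.univ.filter (· ∉ Submodule.span K {p})).card =
      (r + 2) * ((r + 1) * ((r + 2) ^ 2 + (r + 2) + 1)) := by
    apply Nat.add_right_cancel (m := r + 2)
    rw [hcard]
    ring
  rw [hM] at hnot
  rw [show r + 2 - 1 = r + 1 by omega] at hsum
  have hlt := Nat.add_lt_add_of_le_of_lt hmem hnot
  rw [hsum, mul_assoc, ← mul_add] at hlt
  have := Nat.lt_of_mul_lt_mul_left hlt
  nlinarith [Nat.mul_le_mul_left (r + 1) heq]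

/-- Every plane containing a line of an extremal surface meets the surface in the maximal number of
points. -/
lemma sum_zeroCount_eq_of_line [DecidableEq K] {w : Fin 4 → K}
    (hF : F.IsHomogeneous (e + 1))
    (hN : (Finset.univ.filter fun v => eval v F = 0).card = 1 + (Fintype.card K - 1) *
      (e * Fintype.card K ^ 2 + (e + 1) * Fintype.card K + 1))
    (hp0 : p ≠ 0) (hp : eval p F = 0) (hwp : w ∉ Submodule.span K {p})
    (hw : lineRestriction p F w = 0)
    (hplane : ∀ v ∉ Submodule.span K {w, p}, planeRestriction p w F v ≠ 0) :
    ∀ v ∉ Submodule.span K {w, p},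
      ∑ s : K, zeroCount (lineRestriction p F (v + s • w)) = e * Fintype.card K := by
  classical
  have hrank := finrank_span_pair_eq_two hp0 hwp
  have hzero : ∀ v ∈ Submodule.span K {w, p}, eval v F = 0 := by
    intro v hv
    obtain ⟨a, b, rfl⟩ := Submodule.mem_span_pair.mp hv
    rcases eq_or_ne a 0 with rfl | ha
    · rw [zero_smul, zero_add, hF.eval_smul, hp, mul_zero]
    · have : a • w + b • p = a • (w + (a⁻¹ * b) • p) := by
        rw [smul_add, smul_smul, mul_inv_cancel_left₀ ha]
      rw [this, hF.eval_smul, ← eval_lineRestriction, hw, Polynomial.eval_zero, mul_zero]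
  have hle : ∀ v ∈ (Finset.univ : Finset (Fin 4 → K)).filter (· ∉ Submodule.span K {w, p}),
      ∑ s : K, zeroCount (lineRestriction p F (v + s • w)) ≤ e * Fintype.card K := by
    intro v hv
    simp only [← planeRestriction_map_eval]
    exact sum_zeroCount_le (fun k j h => coeff_coeff_planeRestriction_eq_zero hF hw v h)
      (hplane v (by simpa using hv))
  have hcard := card_filter_notMem (Submodule.span K {w, p})
  have hcard' := card_filter_mem (Submodule.span K {w, p})
  have hsum := sum_sum_add_smul (K := K) w fun v => zeroCount (lineRestriction p F v)
  rw [sum_zeroCount_lineRestriction, ← Finset.sum_filter_add_sum_filter_not _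
    (· ∈ Submodule.span K {w, p})] at hsum
  have hmem : ∑ v with v ∈ Submodule.span K {w, p},
      ∑ s : K, zeroCount (lineRestriction p F (v + s • w)) =
      Fintype.card K ^ 2 * Fintype.card K ^ 2 := by
    have hconst : ∀ v ∈ (Finset.univ : Finset (Fin 4 → K)).filter (· ∈ Submodule.span K {w, p}),
        ∑ s : K, zeroCount (lineRestriction p F (v + s • w)) = Fintype.card K ^ 2 := by
      intro v hv
      have hv : v ∈ Submodule.span K {w, p} := by simpa using hv
      have hs : ∀ s : K, zeroCount (lineRestriction p F (v + s • w)) = Fintype.card K := fun s =>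
        zeroCount_lineRestriction_of_forall fun t => hzero _ <|
          add_mem (add_mem hv (Submodule.smul_mem _ _ (Submodule.subset_span (by simp))))
            (Submodule.smul_mem _ _ (Submodule.subset_span (by simp)))
      simp [hs, sq]
    rw [Finset.sum_congr rfl hconst, Finset.sum_const, smul_eq_mul, hcard', hrank]
  have heq : ∑ v with v ∉ Submodule.span K {w, p},
      ∑ s : K, zeroCount (lineRestriction p F (v + s • w)) =
      ∑ v with v ∉ Submodule.span K {w, p}, e * Fintype.card K := by
    rw [Finset.sum_const, smul_eq_mul]
    rw [hrank] at hcard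
    rw [hN, hmem] at hsum
    obtain ⟨r, hr⟩ := Nat.exists_eq_add_of_lt (Fintype.one_lt_card (α := K))
    generalize Fintype.card K = q at *
    obtain rfl : q = r + 2 := by omega
    have hM : (Finset.univ.filter (· ∉ Submodule.span K {w, p})).card =
        (r + 2) ^ 2 * ((r + 1) * (r + 3)) := by
      apply Nat.add_right_cancel (m := (r + 2) ^ 2)
      rw [hcard]
      ring
    rw [hM]
    rw [show r + 2 - 1 = r + 1 by omega] at hsum
    apply Nat.add_left_cancel (n := (r + 2) ^ 2 * (r + 2) ^ 2)
    rw [hsum]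
    ring
  intro v hv
  exact (Finset.sum_eq_sum_iff_of_le hle).mp heq v (by simpa using hv)

end Extremal

section Frame

lemma linMap_apply {n : ℕ} (a v : Fin n → K) : linMap a v = ∑ i, a i * v i := by
  simp [linMap]

lemma aeval_linForm {n : ℕ} {B : Type*} [CommRing B] [Algebra K B] (z : Fin n → B)
    (a : Fin n → K) : aeval z (linForm a) = ∑ i, algebraMap K B (a i) * z i := by
  simp [linForm]

lemma linForm_sub_smul {n : ℕ} (a b : Fin n → K) (s : K) :
    linForm (a - s • b) = linForm a - C s * linForm b := by
  simp [linForm, sub_mul, Finset.sum_sub_distrib, Finset.mul_sum, mul_assoc]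

/-- The coefficients of the coordinate linear forms of a basis. -/
noncomputable def dualCoeff {n : ℕ} (b : Module.Basis (Fin n) K (Fin n → K)) (k : Fin n) :
    Fin n → K := fun i => b.coord k (Pi.single i 1)

lemma linMap_dualCoeff {n : ℕ} (b : Module.Basis (Fin n) K (Fin n → K)) (k : Fin n) :
    linMap (dualCoeff b k) = b.coord k := by
  refine (Pi.basisFun K (Fin n)).ext fun i => ?_
  simp [linMap_apply, dualCoeff, Pi.single_apply]

lemma linMap_sub_smul {n : ℕ} (a b : Fin n → K) (s : K) :
    linMap (a - s • b) = linMap a - s • linMap b := by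
  ext v
  simp [linMap_apply, sub_mul, Finset.sum_sub_distrib, Finset.mul_sum, mul_assoc]

lemma sum_dualCoeff_mul {n : ℕ} (b : Module.Basis (Fin n) K (Fin n → K)) (k j : Fin n) :
    ∑ i, dualCoeff b k i * b j i = if j = k then 1 else 0 := by
  rw [← linMap_apply, linMap_dualCoeff, Module.Basis.coord_apply, Module.Basis.repr_self,
    Finsupp.single_apply]

lemma X_eq_sum_linForm {n : ℕ} (b : Module.Basis (Fin n) K (Fin n → K)) (i : Fin n) :
    (X i : MvPolynomial (Fin n) K) = ∑ j, linForm (dualCoeff b j) * C (b j i) := by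
  simp only [linForm, Finset.sum_mul]
  rw [Finset.sum_comm]
  have h : ∀ k, ∑ j, C (dualCoeff b j k) * X k * C (b j i) =
      (C ((Pi.single k 1 : Fin n → K) i) * X k : MvPolynomial (Fin n) K) := by
    intro k
    have hb := congrFun (b.sum_repr (Pi.single k 1)) i
    rw [← hb, Finset.sum_apply, map_sum, Finset.sum_mul]
    refine Finset.sum_congr rfl fun j _ => ?_
    simp only [dualCoeff, Pi.smul_apply, smul_eq_mul, map_mul, Module.Basis.coord_apply]
    ring
  rw [Finset.sum_congr rfl fun k _ => h k]
  simp [Pi.single_apply]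

variable (b : Module.Basis (Fin 4) K (Fin 4 → K))

lemma linForm_dvd_of_aeval_eq_zero {A : MvPolynomial (Fin 4) K}
    (h : aeval (fun i => X 0 * C (b 1 i) + X 1 * C (b 2 i) + X 2 * C (b 3 i) :
      Fin 4 → MvPolynomial (Fin 3) K) A = 0) : linForm (dualCoeff b 0) ∣ A := by
  rw [← Ideal.mem_span_singleton, ← Ideal.Quotient.eq_zero_iff_mem]
  set I : Ideal (MvPolynomial (Fin 4) K) := Ideal.span {linForm (dualCoeff b 0)} with hI
  let φ : MvPolynomial (Fin 3) K →ₐ[K] MvPolynomial (Fin 4) K ⧸ I :=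
    aeval fun j => Ideal.Quotient.mk I (linForm (dualCoeff b j.succ))
  have hφ : φ.comp (aeval (fun i => X 0 * C (b 1 i) + X 1 * C (b 2 i) + X 2 * C (b 3 i) :
      Fin 4 → MvPolynomial (Fin 3) K)) = Ideal.Quotient.mkₐ K I := by
    ext i
    have h0 : Ideal.Quotient.mk I (linForm (dualCoeff b 0)) = 0 :=
      Ideal.Quotient.eq_zero_iff_mem.mpr (Ideal.mem_span_singleton_self _)
    have hC : ∀ c : K, φ (C c) = Ideal.Quotient.mk I (C c) := fun c => φ.commutes c
    simp only [AlgHom.comp_apply, aeval_X, map_add, map_mul, hC]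
    rw [Ideal.Quotient.mkₐ_eq_mk]
    conv_rhs => rw [X_eq_sum_linForm b i, Fin.sum_univ_four]
    simp only [map_add, map_mul, h0, φ, aeval_X]
    simp [Fin.succ]
  change Ideal.Quotient.mkₐ K I A = 0
  rw [← hφ, AlgHom.comp_apply, h, map_zero]

lemma aeval_frame_eq_zero_of_planeRestriction_eq {e : ℕ} {F : MvPolynomial (Fin 4) K}
    (hF : F.IsHomogeneous (e + 1)) {T : Finset K} (hT : T.card = e) {c : K}
    (h : planeRestriction (b 3) (b 2) F (b 1) =
      Polynomial.C (Polynomial.C c * ∏ s ∈ T, (Polynomial.X - Polynomial.C s)))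
    {E : Type*} [Field E] [Algebra K E] {y : Fin 3 → E} (hy : y 0 ≠ 0) :
    aeval (fun i => y 0 * algebraMap K E (b 1 i) + y 1 * algebraMap K E (b 2 i) +
      y 2 * algebraMap K E (b 3 i)) (F - C c * (linForm (dualCoeff b 1) *
        ∏ s ∈ T, linForm (dualCoeff b 2 - s • dualCoeff b 1))) = 0 := by
  set z : Fin 4 → E := fun i => y 0 * algebraMap K E (b 1 i) + y 1 * algebraMap K E (b 2 i) +
    y 2 * algebraMap K E (b 3 i) with hz
  have hlin : ∀ k, aeval z (linForm (dualCoeff b k)) =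
      (if k = 1 then y 0 else 0) + (if k = 2 then y 1 else 0) + (if k = 3 then y 2 else 0) := by
    intro k
    have hj : ∀ j, ∑ i, algebraMap K E (dualCoeff b k i) * algebraMap K E (b j i) =
        if k = j then 1 else 0 := by
      intro j
      simp only [← map_mul, ← map_sum, sum_dualCoeff_mul, eq_comm]
      split_ifs <;> simp
    have hexp : aeval z (linForm (dualCoeff b k)) =
        y 0 * ∑ i, algebraMap K E (dualCoeff b k i) * algebraMap K E (b 1 i) +
        y 1 * ∑ i, algebraMap K E (dualCoeff b k i) * algebraMap K E (b 2 i) +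
        y 2 * ∑ i, algebraMap K E (dualCoeff b k i) * algebraMap K E (b 3 i) := by
      rw [aeval_linForm, Finset.mul_sum, Finset.mul_sum, Finset.mul_sum, ← Finset.sum_add_distrib,
        ← Finset.sum_add_distrib]
      refine Finset.sum_congr rfl fun i _ => ?_
      simp only [hz]
      ring
    rw [hexp, hj, hj, hj]
    simp
  have hFz : aeval z F =
      y 0 ^ (e + 1) * (algebraMap K E c * ∏ s ∈ T, (y 1 / y 0 - algebraMap K E s)) := by
    have hscale : z = fun i => y 0 * (algebraMap K E (b 1 i) + y 1 / y 0 * algebraMap K E (b 2 i) +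
        y 2 / y 0 * algebraMap K E (b 3 i)) := by
      ext i
      simp only [hz]
      field_simp
    rw [hscale, hF.aeval_mul]
    congr 1
    have hcomp : (Polynomial.aevalAeval (R := K) (y 1 / y 0) (y 2 / y 0)).comp
        (aeval fun i => Polynomial.C (Polynomial.C (b 1 i) + Polynomial.X * Polynomial.C (b 2 i)) +
          Polynomial.X * Polynomial.C (Polynomial.C (b 3 i))) =
        (aeval fun i => (algebraMap K E (b 1 i) + y 1 / y 0 * algebraMap K E (b 2 i) +
          y 2 / y 0 * algebraMap K E (b 3 i)) : MvPolynomial (Fin 4) K →ₐ[K] E) := by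
      ext i
      simp only [AlgHom.comp_apply, aeval_X, map_add, map_mul, Polynomial.aevalAeval_C,
        Polynomial.aevalAeval_Y, Polynomial.aeval_C, Polynomial.aeval_X]
    rw [planeRestriction, lineExpansion_map_aeval] at h
    have := congrArg (Polynomial.aevalAeval (R := K) (y 1 / y 0) (y 2 / y 0)) h
    rw [← hcomp]
    refine Eq.trans this ?_
    simp [Polynomial.eval_prod]
  have hprod : ∏ s ∈ T, (y 1 - algebraMap K E s * y 0) =
      y 0 ^ e * ∏ s ∈ T, (y 1 / y 0 - algebraMap K E s) := by
    rw [← hT, ← Finset.prod_const, ← Finset.prod_mul_distrib]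
    refine Finset.prod_congr rfl fun s _ => ?_
    field_simp
  rw [map_sub, map_mul, map_mul, map_prod, hFz]
  simp only [linForm_sub_smul, map_sub, map_mul, hlin]
  simp [hprod]
  ring

lemma linForm_dvd_sub_of_planeRestriction_eq {e : ℕ} {F : MvPolynomial (Fin 4) K}
    (hF : F.IsHomogeneous (e + 1)) {T : Finset K} (hT : T.card = e) {c : K}
    (h : planeRestriction (b 3) (b 2) F (b 1) =
      Polynomial.C (Polynomial.C c * ∏ s ∈ T, (Polynomial.X - Polynomial.C s))) :
    linForm (dualCoeff b 0) ∣ F - C c * (linForm (dualCoeff b 1) *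
      ∏ s ∈ T, linForm (dualCoeff b 2 - s • dualCoeff b 1)) := by
  apply linForm_dvd_of_aeval_eq_zero
  apply IsFractionRing.injective (MvPolynomial (Fin 3) K) (FractionRing (MvPolynomial (Fin 3) K))
  rw [map_zero, ← aeval_algebraMap_apply]
  have hcomp : (algebraMap (MvPolynomial (Fin 3) K) (FractionRing (MvPolynomial (Fin 3) K)) ∘
      fun i : Fin 4 => X 0 * C (b 1 i) + X 1 * C (b 2 i) + X 2 * C (b 3 i)) =
      fun i =>
        algebraMap (MvPolynomial (Fin 3) K) _ (X 0) * algebraMap K (FractionRing _) (b 1 i) +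
        algebraMap (MvPolynomial (Fin 3) K) _ (X 1) * algebraMap K (FractionRing _) (b 2 i) +
        algebraMap (MvPolynomial (Fin 3) K) _ (X 2) * algebraMap K (FractionRing _) (b 3 i) := by
    ext i
    simp only [Function.comp_apply, map_add, map_mul, IsScalarTower.algebraMap_apply K
      (MvPolynomial (Fin 3) K) (FractionRing (MvPolynomial (Fin 3) K)), algebraMap_eq]
  rw [hcomp]
  exact aeval_frame_eq_zero_of_planeRestriction_eq b hF hT h
    (y := fun j => algebraMap _ (FractionRing (MvPolynomial (Fin 3) K)) (X j)) (by simp [X_ne_zero])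

end Frame

lemma linForm_dvd_of_planeRestriction_eq_zero (b : Module.Basis (Fin 4) K (Fin 4 → K)) [Fintype K]
    {e : ℕ} {F : MvPolynomial (Fin 4) K} (hF : F.IsHomogeneous (e + 1))
    (he : e ≤ Fintype.card K) (h : planeRestriction (b 3) (b 2) F (b 1) = 0) :
    linForm (dualCoeff b 0) ∣ F := by
  obtain ⟨T, -, hT⟩ := Finset.exists_subset_card_eq (s := (Finset.univ : Finset K)) he
  simpa using linForm_dvd_sub_of_planeRestriction_eq b hF hT (c := 0) (by simpa using h)

lemma dualCoeff_ne_zero {n : ℕ} (b : Module.Basis (Fin n) K (Fin n → K)) (k : Fin n) :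
    dualCoeff b k ≠ 0 := by
  intro h
  have := sum_dualCoeff_mul b k k
  simp [h] at this

lemma isPlane_ker_coord (b : Module.Basis (Fin 4) K (Fin 4 → K)) (k : Fin 4) :
    IsPlane (LinearMap.ker (b.coord k)) := by
  have h : b.coord k ≠ 0 := fun h => by simpa using congrArg (fun f => f (b k)) h
  have := Module.Dual.finrank_ker_add_one_of_ne_zero h
  simp at this
  exact this

lemma isLine_ker_inf_ker {f g : (Fin 4 → K) →ₗ[K] K} {v w : Fin 4 → K} (hfv : f v = 1)
    (hfw : f w = 0) (hgw : g w ≠ 0) : IsLine (LinearMap.ker f ⊓ LinearMap.ker g) := by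
  have hsurj : Function.Surjective (f.prod g) := by
    rintro ⟨x, y⟩
    refine ⟨x • v + ((y - x * g v) / g w) • w, ?_⟩
    simp [hfv, hfw, hgw]
  have h := (f.prod g).finrank_range_add_finrank_ker
  rw [LinearMap.range_eq_top.mpr hsurj, LinearMap.ker_prod, finrank_top] at h
  simp at h
  rw [IsLine]
  omega

lemma exists_basis_of_notMem_span {u w p : Fin 4 → K} (hp : p ≠ 0)
    (hw : w ∉ Submodule.span K {p}) (hu : u ∉ Submodule.span K {w, p}) :
    ∃ b : Module.Basis (Fin 4) K (Fin 4 → K), b 1 = u ∧ b 2 = w ∧ b 3 = p := by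
  have h3 : LinearIndependent K ![u, w, p] := by
    refine linearIndependent_finCons.mpr ⟨linearIndependent_finCons.mpr
      ⟨by simpa using hp, by simpa using hw⟩, ?_⟩
    simpa [Matrix.range_cons, Matrix.range_empty, Set.pair_comm] using hu
  obtain ⟨x, hx⟩ : ∃ x, x ∉ Submodule.span K (Set.range ![u, w, p]) := by
    by_contra! h
    have := finrank_span_eq_card h3
    rw [Submodule.eq_top_iff'.mpr h] at this
    simp at this
  have h4 : LinearIndependent K ![x, u, w, p] := linearIndependent_finCons.mpr ⟨h3, hx⟩
  refine ⟨basisOfLinearIndependentOfCardEqFinrank h4 (by simp), ?_, ?_, ?_⟩ <;> simp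

theorem isPencil_of_planeRestriction_eq (b : Module.Basis (Fin 4) K (Fin 4 → K)) {e : ℕ}
    {F : MvPolynomial (Fin 4) K} (hF : F.IsHomogeneous (e + 1))
    (hF0 : ¬ linForm (dualCoeff b 0) ∣ F) {T : Finset K} (hT : T.card = e) {c : K}
    (h : planeRestriction (b 3) (b 2) F (b 1) =
      Polynomial.C (Polynomial.C c * ∏ s ∈ T, (Polynomial.X - Polynomial.C s)))
    (P : Projectivization K (Fin 4 → K)) (hP : P.rep = b 3) :
    IsPencil F (e + 1) (LinearMap.ker (b.coord 0)) P := by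
  obtain ⟨g, hg⟩ := linForm_dvd_sub_of_planeRestriction_eq b hF hT h
  subst hT
  let m : Fin (T.card + 1) → Fin 4 → K :=
    Fin.cons (dualCoeff b 1) fun i => dualCoeff b 2 - (T.equivFin.symm i : K) • dualCoeff b 1
  have hm0 : linMap (m 0) = b.coord 1 := linMap_dualCoeff b 1
  have hmS : ∀ i : Fin T.card,
      linMap (m i.succ) = b.coord 2 - (T.equivFin.symm i : K) • b.coord 1 := fun i => by
    simp only [m, Fin.cons_succ, linMap_sub_smul, linMap_dualCoeff]
  have hprod : ∏ i, linForm (m i) = linForm (dualCoeff b 1) *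
      ∏ s ∈ T, linForm (dualCoeff b 2 - s • dualCoeff b 1) := by
    rw [Fin.prod_univ_succ, ← Finset.prod_coe_sort T, ← Equiv.prod_comp T.equivFin.symm]
    simp [m]
  refine ⟨dualCoeff b 0, m, c, g, dualCoeff_ne_zero b 0, by rw [linMap_dualCoeff], ?_, ?_, ?_, ?_,
    ?_, ?_⟩
  · rintro rfl
    refine hF0 ⟨g, ?_⟩
    rw [← hg, C_0, zero_mul, sub_zero]
  · rw [hprod, ← hg]
    ring
  · intro i
    rw [linMap_dualCoeff]
    cases i using Fin.cases with
    | zero =>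
      rw [hm0]
      exact isLine_ker_inf_ker (v := b 0) (w := b 1) (by simp) (by simp) (by simp)
    | succ i =>
      rw [hmS]
      exact isLine_ker_inf_ker (v := b 0) (w := b 2) (by simp) (by simp) (by simp)
  · have hne : ∀ i : Fin T.card, LinearMap.ker (b.coord 0) ⊓ LinearMap.ker (b.coord 1) ≠
        LinearMap.ker (b.coord 0) ⊓
          LinearMap.ker (b.coord 2 - (T.equivFin.symm i : K) • b.coord 1) := by
      intro i h
      have := h.le (x := b 2) (by simp)
      simp at this
    intro i j hij
    rw [linMap_dualCoeff]
    cases i using Fin.cases with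
    | zero =>
      cases j using Fin.cases with
      | zero => exact absurd rfl hij
      | succ j =>
        rw [hm0, hmS]
        exact hne j
    | succ i =>
      cases j using Fin.cases with
      | zero =>
        rw [hm0, hmS]
        exact (hne i).symm
      | succ j =>
        rw [hmS, hmS]
        intro h
        have := h.le (x := b 1 + (T.equivFin.symm i : K) • b 2) (by simp)
        simp [sub_eq_zero] at this
        exact hij (by rw [this])
  · simp [hP]
  · intro i
    rw [hP]
    cases i using Fin.cases with
    | zero => simp [hm0]
    | succ i => simp [hmS]

/-- Let `S` be a surface of degree `d` (`2 ≤ d ≤ q+1`) in `P^3` over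
`F_q` without `F_q`-plane components attaining the elementary bound. Then through every
`F_q`-point `P` of `S` there is an `F_q`-plane `H` such that `S ∩ H` is a planar
`F_q`-pencil of degree `d` with vertex `P`. -/
theorem pencil_with_prescribed_vertex (K : Type) [Field K] [Fintype K]
    (d : ℕ) (F : MvPolynomial (Fin 4) K)
    (hhom : F.IsHomogeneous d) (hsf : Squarefree F)
    (hnoplane : ¬ ∃ a : Fin 4 → K, a ≠ 0 ∧ linForm a ∣ F)
    (hd2 : 2 ≤ d) (hdq : d ≤ Fintype.card K + 1)
    (hN : Nat.card {p : Projectivization K (Fin 4 → K) // MvPolynomial.eval p.rep F = 0} =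
      (d - 1) * Fintype.card K ^ 2 + d * Fintype.card K + 1) :
    ∀ P : Projectivization K (Fin 4 → K), MvPolynomial.eval P.rep F = 0 →
      ∃ H : Submodule K (Fin 4 → K), IsPlane H ∧ IsPencil F d H P := by
  classical
  intro P hP
  obtain ⟨e, rfl⟩ := Nat.exists_eq_add_of_le' (show 1 ≤ d by omega)
  have he : e ≤ Fintype.card K := by omega
  have hcard := card_zeros_eq hhom (by omega)
  rw [hN, Nat.add_sub_cancel] at hcard
  obtain ⟨w, hwP, hw⟩ :=
    exists_lineRestriction_eq_zero hhom (by omega) he hcard P.rep_nonzero hP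
  have hplane : ∀ v ∉ Submodule.span K {w, P.rep}, planeRestriction P.rep w F v ≠ 0 := by
    intro v hv h
    obtain ⟨b, rfl, rfl, hb⟩ := exists_basis_of_notMem_span P.rep_nonzero hwP hv
    rw [← hb] at h
    exact hnoplane ⟨_, dualCoeff_ne_zero b 0, linForm_dvd_of_planeRestriction_eq_zero b hhom he h⟩
  obtain ⟨l, hl⟩ := exists_linearMap_coeff_lineRestriction hhom P.rep
  obtain ⟨u, hu, hlu⟩ := exists_notMem_of_finrank_lt_three _
    (by rw [finrank_span_pair_eq_two P.rep_nonzero hwP]; norm_num) l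
  have hzero : ∀ k j, e < k + j → ((planeRestriction P.rep w F u).coeff k).coeff j = 0 :=
    fun k j h => coeff_coeff_planeRestriction_eq_zero hhom hw u h
  have htop : (planeRestriction P.rep w F u).coeff e = 0 := by
    ext j
    rcases Nat.eq_zero_or_pos j with rfl | hj
    · rw [coeff_planeRestriction, Polynomial.coeff_zero_eq_eval_zero, eval_lineRestriction, zero_smul,
        add_zero, ← coeff_lineRestriction, hl, hlu, Polynomial.coeff_zero]
    · exact hzero e j (by omega)
  obtain ⟨T, c, hT, hc⟩ := exists_eq_C_prod_of_sum_zeroCount_eq hzero (hplane u hu) htop <| by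
    simp only [planeRestriction_map_eval]
    exact sum_zeroCount_eq_of_line hhom hcard P.rep_nonzero hP hwP hw hplane u hu
  obtain ⟨b, rfl, rfl, hb⟩ := exists_basis_of_notMem_span P.rep_nonzero hwP hu
  rw [← hb] at hc
  exact ⟨_, isPlane_ker_coord b 0, isPencil_of_planeRestriction_eq b hhom
    (fun h => hnoplane ⟨_, dualCoeff_ne_zero b 0, h⟩) hT hc P hb.symm⟩
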